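/- Let k be a field of characteristic p > 0. Every affine normal semigroup ring over k (the semigroup ring k[S] of a finitely generated normal submonoid S of ℤ^n) is strongly F-regular; in particular it is Cohen–Macaulay. -/

import Mathlib

open CategoryTheory

/-- Depth via local cohomology at the maximal ideal (following the paper). -/
noncomputable def localDepth (A : Type) [CommRing A] [IsLocalRing A]
    (M : Type) [AddCommGroup M] [Module A M] : ℕ∞ :=
  sInf {n : ℕ∞ | ∃ m : ℕ, n = (m : ℕ∞) ∧
    Nontrivial ((localCohomology (IsLocalRing.maximalIdeal A) m).obj (ModuleCat.of A M))}

/-- `depth_{A_P} M_P` for a prime `P`. -/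
noncomputable def primeLocalDepth (A : Type) [CommRing A] (P : Ideal A)
    (hP : P.IsPrime) (M : Type) [AddCommGroup M] [Module A M] : ℕ∞ :=
  haveI := hP
  localDepth (Localization.AtPrime P) (LocalizedModule P.primeCompl M)

/-- `dim A_P`, the height of the prime `P`. -/
noncomputable def primeKrullDim (A : Type) [CommRing A] (P : Ideal A)
    (hP : P.IsPrime) : WithBot ℕ∞ :=
  haveI := hP
  ringKrullDim (Localization.AtPrime P)

/-- `dim M_P`, the dimension of the localized module. -/
noncomputable def primeModuleDim (A : Type) [CommRing A] (P : Ideal A)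
    (hP : P.IsPrime) (M : Type) [AddCommGroup M] [Module A M] : WithBot ℕ∞ :=
  haveI := hP
  Order.krullDim
    (Module.support (Localization.AtPrime P) (LocalizedModule P.primeCompl M))

/-- Serre's condition `(S_n)`: `depth M_P ≥ min (n, dim M_P)` for all primes `P`. -/
def SerreS (A : Type) [CommRing A] (M : Type) [AddCommGroup M] [Module A M]
    (n : ℕ) : Prop :=
  ∀ (P : Ideal A) (hP : P.IsPrime),
    min (n : WithBot ℕ∞) (primeModuleDim A P hP M) ≤
      (primeLocalDepth A P hP M : WithBot ℕ∞)

/-- Serre's condition `(S'_n)`: `depth M_P ≥ min (n, dim A_P)` for all primes `P`. -/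
def SerreS' (A : Type) [CommRing A] (M : Type) [AddCommGroup M] [Module A M]
    (n : ℕ) : Prop :=
  ∀ (P : Ideal A) (hP : P.IsPrime),
    min (n : WithBot ℕ∞) (primeKrullDim A P hP) ≤
      (primeLocalDepth A P hP M : WithBot ℕ∞)

/-- A ring `R` of characteristic `p` is strongly F-regular if for every `c ∈ R`
not in any minimal prime there are `e ≥ 1` and an additive map `φ : R → R` with
`φ (r^{p^e} * x) = r * φ x` (i.e. an `R`-linear map `F^e_* R → R`) sending `c`
to `1`; equivalently, the map `R → F^e_* R`, `1 ↦ c` splits `R`-linearly. -/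
def IsStronglyFRegular (R : Type) [CommRing R] (p : ℕ) : Prop :=
  ∀ c : R, (∀ P ∈ minimalPrimes R, c ∉ P) →
    ∃ (e : ℕ) (φ : R →+ R), 1 ≤ e ∧
      (∀ r x : R, φ (r ^ p ^ e * x) = r * φ x) ∧ φ c = 1

/-- A commutative ring is Cohen–Macaulay if `depth = dim` at every prime. -/
def IsCohenMacaulayRing (R : Type) [CommRing R] : Prop :=
  ∀ (P : Ideal R) (hP : P.IsPrime),
    (primeLocalDepth R P hP R : WithBot ℕ∞) = primeKrullDim R P hP

section HomologicalDepth

open Limits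

lemma HomologicalComplex.mono_homologyMap_of_forall {B : Type} [CommRing B]
    {ι : Type*} {c : ComplexShape ι}
    {K L : HomologicalComplex (ModuleCat.{0} B) c} (ψ : K ⟶ L) (n : ι)
    (h : ∀ x : K.X n, K.d n (c.next n) x = 0 →
      (∃ y : L.X (c.prev n), L.d (c.prev n) n y = ψ.f n x) →
      ∃ y : K.X (c.prev n), K.d (c.prev n) n y = x) :
    Mono (HomologicalComplex.homologyMap ψ n) := by
  rw [ModuleCat.mono_iff_injective, injective_iff_map_eq_zero]
  intro z hz
  obtain ⟨w, rfl⟩ := (ModuleCat.epi_iff_surjective (K.homologyπ n)).1 inferInstance z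
  have key (M : HomologicalComplex (ModuleCat.{0} B) c) (v : M.cycles n) :
      M.homologyπ n v = 0 ↔ ∃ y, M.d (c.prev n) n y = M.iCycles n v := by
    have ex := ShortComplex.exact_of_g_is_cokernel
      (ShortComplex.mk (M.toCycles (c.prev n) n) (M.homologyπ n)
        (M.toCycles_comp_homologyπ _ _)) (M.homologyIsCokernel (c.prev n) n rfl)
    rw [ShortComplex.moduleCat_exact_iff] at ex
    constructor
    · intro hv
      obtain ⟨y, hy⟩ := ex v hv
      refine ⟨y, ?_⟩
      rw [← hy]
      change _ = (M.toCycles _ _ ≫ M.iCycles n) y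
      rw [M.toCycles_i]
    · rintro ⟨y, hy⟩
      have : M.toCycles (c.prev n) n y = v := by
        apply (ModuleCat.mono_iff_injective (M.iCycles n)).1 inferInstance
        rw [← hy]
        change (M.toCycles _ _ ≫ M.iCycles n) y = _
        rw [M.toCycles_i]
      rw [← this]
      change (M.toCycles _ _ ≫ M.homologyπ n) y = _
      rw [M.toCycles_comp_homologyπ]; rfl
  rw [key]
  apply h
  · change (K.iCycles n ≫ K.d _ _) w = 0
    rw [K.iCycles_d]; rfl
  · have : L.homologyπ n (HomologicalComplex.cyclesMap ψ n w) = 0 := by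
      rw [← hz]
      change (HomologicalComplex.cyclesMap ψ n ≫ L.homologyπ n) w =
        (K.homologyπ n ≫ HomologicalComplex.homologyMap ψ n) w
      rw [HomologicalComplex.homologyπ_naturality]
    obtain ⟨y, hy⟩ := (key _ _).1 this
    refine ⟨y, hy.trans ?_⟩
    change (HomologicalComplex.cyclesMap ψ n ≫ L.iCycles n) w = (K.iCycles n ≫ ψ.f n) w
    rw [HomologicalComplex.cyclesMap_i]

/-- The morphism of cochain complexes `Hom(P, Y) ⟶ Hom(P', Y)` induced by `P' ⟶ P`. -/
noncomputable def ChainComplex.linearYonedaMap {B : Type} [CommRing B]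
    {P P' : ChainComplex (ModuleCat.{0} B) ℕ} (φ : P' ⟶ P) (Y : ModuleCat.{0} B) :
    P.linearYonedaObj B Y ⟶ P'.linearYonedaObj B Y :=
  (HomologicalComplex.unopFunctor _ _).map
    (((((linearYoneda B (ModuleCat.{0} B)).obj Y).rightOp.mapHomologicalComplex _).map φ).op)

lemma mono_ext_map_of_mono_homologyMap {B : Type} [CommRing B]
    {N N' : ModuleCat.{0} B} (g : N' ⟶ N) (P : ProjectiveResolution N)
    (P' : ProjectiveResolution N') (φ : P'.Hom P g) (Y : ModuleCat.{0} B) (n : ℕ)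
    (h : Mono (HomologicalComplex.homologyMap (ChainComplex.linearYonedaMap φ.hom Y) n)) :
    Mono (((Ext B (ModuleCat.{0} B) n).map g.op).app Y) := by
  let F := ((linearYoneda B (ModuleCat.{0} B)).obj Y).rightOp
  change Mono ((F.leftDerived n).map g).unop
  suffices Epi ((F.leftDerived n).map g) from inferInstance
  rw [Functor.leftDerived_map_eq F n g (P := P') (Q := P) φ.hom φ.hom_comp_π]
  suffices Epi ((F.mapHomologicalComplex _ ⋙ HomologicalComplex.homologyFunctor _ _ n).map φ.hom)
    from inferInstance
  have := HomologicalComplex.homologyOp_hom_naturality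
    (ChainComplex.linearYonedaMap φ.hom Y) n
  suffices Epi (HomologicalComplex.homologyMap ((HomologicalComplex.opFunctor _ _).map
    (ChainComplex.linearYonedaMap φ.hom Y).op) n) from this
  have h2 := (Iso.eq_comp_inv _).2 this
  have : Epi (HomologicalComplex.homologyMap (ChainComplex.linearYonedaMap φ.hom Y) n).op :=
    inferInstance
  rw [h2]
  exact epi_comp' (epi_comp' (@IsIso.epi_of_iso _ _ _ _ _ (Iso.isIso_hom _)) this)
    (@IsIso.epi_of_iso _ _ _ _ _ (Iso.isIso_inv _))

lemma CategoryTheory.ProjectiveResolution.extMk_eq_zero_iff_exists_prev {B : Type} [CommRing B]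
    {N Y : ModuleCat.{0} B} (P : ProjectiveResolution N) (n : ℕ)
    (f : P.complex.X n ⟶ Y) (hf : P.complex.d (n + 1) n ≫ f = 0) :
    P.extMk f (n + 1) rfl hf = 0 ↔
      ∃ g : P.complex.X ((ComplexShape.up ℕ).prev n) ⟶ Y,
        P.complex.d n ((ComplexShape.up ℕ).prev n) ≫ g = f := by
  cases n with
  | succ n =>
    rw [P.extMk_eq_zero_iff f _ rfl hf n rfl, CochainComplex.prev_nat_succ]
  | zero =>
    rw [CochainComplex.prev_nat_zero, P.complex.shape 0 0 (by simp)]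
    constructor
    · intro h
      refine ⟨0, ?_⟩
      rw [← (P.extEquivCohomologyClass).apply_eq_iff_eq, extEquivCohomologyClass_extMk,
        extEquivCohomologyClass_zero,
        CochainComplex.HomComplex.CohomologyClass.mk_eq_zero_iff] at h
      rw [CochainComplex.HomComplex.Cocycle.toSingleMk_mem_coboundaries_iff _ _ _ _ _ 1
        (by lia)] at h
      obtain ⟨g, hg⟩ := h
      have hz : IsZero (P.cochainComplex.X 1) :=
        HomologicalComplex.isZero_extend_X _ _ _ fun i => by simp; lia
      rw [hz.eq_of_src g 0, comp_zero] at hg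
      have hg' := (cancel_epi (P.cochainComplexXIso (-(0 : ℕ)) 0 rfl).hom).1
        (hg.symm.trans comp_zero.symm)
      rw [hg', comp_zero]
    · rintro ⟨g, rfl⟩
      simp

lemma mono_ext_map_of_injective {B : Type} [CommRing B]
    {N N' : ModuleCat.{0} B} (g : N' ⟶ N) (Y : ModuleCat.{0} B) (n : ℕ)
    (h : ∀ x : Abelian.Ext N Y n, (Abelian.Ext.mk₀ g).comp x (zero_add n) = 0 → x = 0) :
    Mono (((Ext B (ModuleCat.{0} B) n).map g.op).app Y) := by
  obtain ⟨P⟩ := HasProjectiveResolution.out (Z := N)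
  obtain ⟨P'⟩ := HasProjectiveResolution.out (Z := N')
  let φ : P'.Hom P g :=
    ⟨ProjectiveResolution.lift g P' P, ProjectiveResolution.lift_commutes_zero g P' P⟩
  refine mono_ext_map_of_mono_homologyMap g P P' φ Y n
    (HomologicalComplex.mono_homologyMap_of_forall _ _ fun x hx => ?_)
  rw [CochainComplex.next] at hx
  change P.complex.X n ⟶ Y at x
  change P.complex.d (n + 1) n ≫ x = 0 at hx
  rintro ⟨y, hy⟩
  change P'.complex.X ((ComplexShape.up ℕ).prev n) ⟶ Y at y
  change P'.complex.d n ((ComplexShape.up ℕ).prev n) ≫ y = φ.hom.f n ≫ x at hy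
  refine (P.extMk_eq_zero_iff_exists_prev n x hx).1 (h _ ?_)
  rw [ProjectiveResolution.mk₀_comp_extMk x _ _ hx φ]
  exact (P'.extMk_eq_zero_iff_exists_prev n _ _).2 ⟨y, hy⟩

lemma isZero_ext_of_subsingleton {B : Type} [CommRing B]
    {N Y : ModuleCat.{0} B} (n : ℕ) (h : Subsingleton (Abelian.Ext N Y n)) :
    IsZero (((Ext B (ModuleCat.{0} B) n).obj (.op N)).obj Y) := by
  obtain ⟨P⟩ := HasProjectiveResolution.out (Z := N)
  refine IsZero.of_iso ?_ (P.isoExt n Y)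
  rw [← HomologicalComplex.exactAt_iff_isZero_homology, HomologicalComplex.exactAt_iff,
    ShortComplex.moduleCat_exact_iff]
  intro x hx
  change P.complex.X n ⟶ Y at x
  change P.complex.d ((ComplexShape.up ℕ).next n) n ≫ x = 0 at hx
  rw [CochainComplex.next] at hx
  exact (P.extMk_eq_zero_iff_exists_prev n x hx).1 (Subsingleton.elim _ _)

lemma subsingleton_ext_of_isZero {B : Type} [CommRing B]
    {N Y : ModuleCat.{0} B} (n : ℕ)
    (h : IsZero (((Ext B (ModuleCat.{0} B) n).obj (.op N)).obj Y)) :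
    Subsingleton (Abelian.Ext N Y n) := by
  obtain ⟨P⟩ := HasProjectiveResolution.out (Z := N)
  have h1 := h.of_iso (P.isoExt n Y).symm
  rw [← HomologicalComplex.exactAt_iff_isZero_homology, HomologicalComplex.exactAt_iff,
    ShortComplex.moduleCat_exact_iff] at h1
  refine subsingleton_of_forall_eq 0 fun α => ?_
  obtain ⟨f, hf, rfl⟩ := P.extMk_surjective α (n + 1) rfl
  refine (P.extMk_eq_zero_iff_exists_prev n f hf).2 (h1 f ?_)
  change P.complex.d ((ComplexShape.up ℕ).next n) n ≫ f = 0
  rwa [CochainComplex.next]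

lemma CategoryTheory.Abelian.Ext.eq_zero_of_mk₀_comp_eq_zero_of_epi {B : Type} [CommRing B]
    {N N' Y : ModuleCat.{0} B} (g : N' ⟶ N) [Epi g] (n : ℕ)
    (h : ∀ i < n, Subsingleton (Abelian.Ext (kernel g) Y i))
    (x : Abelian.Ext N Y n) (hx : (Abelian.Ext.mk₀ g).comp x (zero_add n) = 0) : x = 0 := by
  cases n with
  | zero => exact Abelian.Ext.precomp_mk₀_injective_of_epi Y g (hx.trans (by simp))
  | succ n =>
    have hS : (ShortComplex.mk (kernel.ι g) g (kernel.condition g)).ShortExact :=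
      { exact := ShortComplex.exact_kernel g }
    obtain ⟨y, rfl⟩ := Abelian.Ext.contravariant_sequence_exact₃ hS Y x hx (add_comm 1 n)
    have := h n n.lt_succ_self
    rw [Subsingleton.elim y 0, Abelian.Ext.comp_zero]

namespace localCohomology

variable {B : Type} [CommRing B] (J : Ideal B) (i : ℕ) (Y : ModuleCat.{0} B)

/-- The colimit cocone computing the value of local cohomology at a module. -/
noncomputable def objCocone :
    Cocone (diagram (idealPowersDiagram J) i ⋙ (evaluation _ _).obj Y) :=
  ((evaluation _ _).obj Y).mapCocone (colimit.cocone (diagram (idealPowersDiagram J) i))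

/-- Evaluation at a module preserves the colimit defining local cohomology. -/
noncomputable def objCoconeIsColimit : IsColimit (objCocone J i Y) :=
  isColimitOfPreserves ((evaluation _ _).obj Y) (colimit.isColimit _)

lemma isZero_obj
    (h : ∀ t : ℕ, Subsingleton (Abelian.Ext (ModuleCat.of B (B ⧸ J ^ t)) Y i)) :
    IsZero ((localCohomology J i).obj Y) := by
  rw [IsZero.iff_id_eq_zero]
  refine (objCoconeIsColimit J i Y).hom_ext fun t => ?_
  exact (isZero_ext_of_subsingleton i (h t.unop.unop)).eq_of_src _ _

lemma nontrivial_obj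
    (h : ∀ (s t : ℕ) (g : ModuleCat.of B (B ⧸ J ^ t) ⟶ ModuleCat.of B (B ⧸ J ^ s)),
      Epi g → ∀ x : Abelian.Ext (ModuleCat.of B (B ⧸ J ^ s)) Y i,
        (Abelian.Ext.mk₀ g).comp x (zero_add i) = 0 → x = 0)
    (s : ℕ) (hs : Nontrivial (Abelian.Ext (ModuleCat.of B (B ⧸ J ^ s)) Y i)) :
    Nontrivial ((localCohomology J i).obj Y) := by
  have hm : ∀ (a b : (ℕᵒᵖ)ᵒᵖ) (f : a ⟶ b),
      Mono ((diagram (idealPowersDiagram J) i ⋙ (evaluation _ _).obj Y).map f) := by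
    intro a b f
    refine mono_ext_map_of_injective _ Y i (h _ _ _ ?_)
    exact (ModuleCat.epi_iff_surjective _).2
      (Submodule.factor_surjective ((idealPowersDiagram J).map f.unop).down.down)
  have := (objCoconeIsColimit J i Y).mono_ι_app_of_isFiltered (.op (.op s))
  by_contra hc
  rw [not_nontrivial_iff_subsingleton] at hc
  have h0 : IsZero ((objCocone J i Y).pt) := @ModuleCat.isZero_of_subsingleton _ _ _ hc
  have h1 := IsZero.of_mono_eq_zero _ (h0.eq_of_tgt ((objCocone J i Y).ι.app (.op (.op s))) 0)
  exact not_subsingleton_iff_nontrivial.2 hs (subsingleton_ext_of_isZero i h1)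

end localCohomology

open IsLocalRing RingTheory.Sequence in
theorem localDepth_eq_of_isRegular (B : Type) [CommRing B] [IsLocalRing B] [IsNoetherianRing B]
    (M : Type) [AddCommGroup M] [Module B M] [Module.Finite B M] [Nontrivial M]
    (rs : List B) (mem : ∀ r ∈ rs, r ∈ maximalIdeal B) (reg : IsRegular M rs)
    (hmax : ∀ rs' : List B, (∀ r ∈ rs', r ∈ maximalIdeal B) → IsRegular M rs' →
      rs'.length ≤ rs.length) :
    localDepth B M = rs.length := by
  have hlt : maximalIdeal B • (⊤ : Submodule B (ModuleCat.of B M)) < ⊤ :=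
    (Submodule.top_ne_ideal_smul_of_le_jacobson_annihilator
      (maximalIdeal_le_jacobson _)).symm.lt_top
  have hsupp (t : ℕ) : Module.support B (B ⧸ maximalIdeal B ^ t) ⊆
      PrimeSpectrum.zeroLocus (maximalIdeal B) := by
    rw [Module.support_eq_zeroLocus, Ideal.annihilator_quotient]
    intro P hP
    exact P.2.le_of_pow_le hP
  have hvan (N : ModuleCat.{0} B) [Module.Finite B N]
      (hN : Module.support B N ⊆ PrimeSpectrum.zeroLocus (maximalIdeal B)) :
      ∀ i < rs.length, Subsingleton (Abelian.Ext N (ModuleCat.of B M) i) :=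
    ModuleCat.subsingleton_ext_of_exists_isRegular _ N hN (ModuleCat.of B M) hlt rs mem reg
  apply le_antisymm
  · refine sInf_le ⟨rs.length, rfl, localCohomology.nontrivial_obj _ _ _ ?_ 1 ?_⟩
    · intro s t g hg
      refine Abelian.Ext.eq_zero_of_mk₀_comp_eq_zero_of_epi g _ ?_
      have hinj : Function.Injective (kernel.ι (C := ModuleCat.{0} B) g).hom :=
        (ModuleCat.mono_iff_injective (kernel.ι (C := ModuleCat.{0} B) g)).1 inferInstance
      have : Module.Finite B (kernel (C := ModuleCat.{0} B) g) :=
        Module.Finite.of_injective (kernel.ι (C := ModuleCat.{0} B) g).hom hinj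
      exact hvan _ ((Module.support_subset_of_injective _ hinj).trans (hsupp t))
    · by_contra hc
      rw [not_nontrivial_iff_subsingleton] at hc
      obtain ⟨rs', hlen, hmem, hreg⟩ :=
        ModuleCat.exists_isRegular_of_exists_subsingleton_ext (maximalIdeal B) (rs.length + 1)
        (ModuleCat.of B M) hlt (ModuleCat.of B (B ⧸ maximalIdeal B ^ 1))
        (by rw [Module.support_eq_zeroLocus, Ideal.annihilator_quotient, pow_one]) (fun i hi => by
          rcases Nat.lt_succ_iff_lt_or_eq.1 hi with h | rfl
          · exact hvan _ (hsupp 1) i h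
          · exact hc)
      have := hmax rs' hmem hreg
      omega
  · refine le_sInf ?_
    rintro _ ⟨m, rfl, hm⟩
    by_contra hc
    have hc : m < rs.length := by simpa using hc
    have := localCohomology.isZero_obj (maximalIdeal B) m (ModuleCat.of B M)
      fun t => hvan _ (hsupp t) m hc
    exact not_subsingleton_iff_nontrivial.2 hm (ModuleCat.subsingleton_of_isZero this)

open IsLocalRing RingTheory.Sequence in
theorem localDepth_eq_ringKrullDim (B : Type) [CommRing B] [IsLocalRing B] [IsNoetherianRing B]
    (M : Type) [AddCommGroup M] [Module B M] (ε : M ≃ₗ[B] B)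
    (rs : List B) (mem : ∀ r ∈ rs, r ∈ maximalIdeal B) (reg : IsWeaklyRegular B rs)
    (hdim : ringKrullDim B ≤ rs.length) :
    (localDepth B M : WithBot ℕ∞) = ringKrullDim B := by
  have hreg : ∀ rs' : List B, (∀ r ∈ rs', r ∈ maximalIdeal B) → IsWeaklyRegular B rs' →
      IsRegular B rs' := fun rs' mem' reg' =>
    (isRegular_iff_isWeaklyRegular_of_subset_maximalIdeal mem').2 reg'
  have hle : ∀ rs' : List B, IsRegular B rs' → (rs'.length : WithBot ℕ∞) ≤ ringKrullDim B := by
    intro rs' reg'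
    rw [← ringKrullDim_add_length_eq_ringKrullDim_of_isRegular rs' reg']
    have : Nontrivial (B ⧸ Ideal.ofList rs') := by
      rw [Ideal.Quotient.nontrivial_iff]
      simpa using reg'.top_ne_smul.symm
    exact le_add_of_nonneg_left ringKrullDim_nonneg_of_nontrivial
  have : Nontrivial M := ε.toEquiv.nontrivial
  have : Module.Finite B M := Module.Finite.equiv ε.symm
  have heq := hdim.antisymm (hle rs (hreg rs mem reg))
  rw [localDepth_eq_of_isRegular B M rs mem ((ε.isRegular_congr rs).2 (hreg rs mem reg)), heq]
  · rfl
  · intro rs' mem' reg'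
    have := (hle rs' ((ε.isRegular_congr rs').1 reg')).trans hdim
    exact_mod_cast this

open IsLocalRing RingTheory.Sequence Pointwise in
lemma exists_isWeaklyRegular_pow_of_subsingleton_ext {B : Type} [CommRing B] [IsLocalRing B]
    [IsNoetherianRing B] {Q : B → Prop}
    (hQ : ∀ x ∈ maximalIdeal B, ∃ u : B, IsUnit u ∧ Q (u * x)) (q : ℕ) (n : ℕ)
    (M : ModuleCat.{0} B) [Module.Finite B M]
    (h_ext : ∀ i < n, Subsingleton (Abelian.Ext (ModuleCat.of B (B ⧸ maximalIdeal B)) M i)) :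
    ∃ rs : List B, rs.length = n ∧ (∀ r ∈ rs, r ∈ maximalIdeal B ∧ Q r) ∧
      IsWeaklyRegular M (rs.map (· ^ q)) := by
  induction n generalizing M with
  | zero => exact ⟨[], by simp⟩
  | succ n ih =>
    let N := ModuleCat.of B (B ⧸ maximalIdeal B)
    have : Subsingleton (N ⟶ M) := Abelian.Ext.addEquiv₀.subsingleton_congr.mp
      (h_ext 0 n.zero_lt_succ)
    have : Subsingleton (N →ₗ[B] M) := ModuleCat.homAddEquiv.symm.subsingleton
    obtain ⟨x, mem_ann, hx⟩ := IsSMulRegular.subsingleton_linearMap_iff.mp this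
    rw [Ideal.annihilator_quotient] at mem_ann
    obtain ⟨u, hu, hux⟩ := hQ x mem_ann
    have hy : IsSMulRegular M (u * x) :=
      IsSMulRegular.mul (hu.isSMulRegular _) hx
    have h_ext' : ∀ i < n, Subsingleton
        (Abelian.Ext N (ModuleCat.of B (QuotSMulTop ((u * x) ^ q) M)) i) := by
      intro i hi
      have zero1 := AddCommGrpCat.isZero_of_iff_subsingleton.mpr (h_ext i (by omega))
      have zero2 := AddCommGrpCat.isZero_of_iff_subsingleton.mpr (h_ext (i + 1) (by omega))
      exact AddCommGrpCat.subsingleton_of_isZero <| ShortComplex.Exact.isZero_of_both_zeros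
        ((Abelian.Ext.covariant_sequence_exact₃' N (hy.pow q).smulShortComplex_shortExact)
          i (i + 1) rfl)
        (zero1.eq_zero_of_src _) (zero2.eq_zero_of_tgt _)
    obtain ⟨rs, len, mem, reg⟩ := ih (ModuleCat.of B (QuotSMulTop ((u * x) ^ q) M)) h_ext'
    refine ⟨(u * x) :: rs, by simp [len], ?_, ?_⟩
    · exact List.forall_mem_cons.2 ⟨⟨Ideal.mul_mem_left _ u mem_ann, hux⟩, mem⟩
    · simpa using ⟨hy.pow q, reg⟩

open IsLocalRing RingTheory.Sequence in
/-- In a local ring with a regular sequence of length `n` there are regular sequences of length `n`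
consisting of `q`-th powers. -/
lemma exists_isWeaklyRegular_pow {B : Type} [CommRing B] [IsLocalRing B]
    [IsNoetherianRing B] {Q : B → Prop}
    (hQ : ∀ x ∈ maximalIdeal B, ∃ u : B, IsUnit u ∧ Q (u * x)) (q : ℕ)
    (rs : List B) (mem : ∀ r ∈ rs, r ∈ maximalIdeal B) (reg : IsWeaklyRegular B rs) :
    ∃ rs' : List B, rs'.length = rs.length ∧ (∀ r ∈ rs', r ∈ maximalIdeal B ∧ Q r) ∧
      IsWeaklyRegular B (rs'.map (· ^ q)) := by
  refine exists_isWeaklyRegular_pow_of_subsingleton_ext hQ q rs.length (ModuleCat.of B B) ?_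
  refine ModuleCat.subsingleton_ext_of_exists_isRegular (maximalIdeal B) _ ?_ (ModuleCat.of B B) ?_
    rs mem ((isRegular_iff_isWeaklyRegular_of_subset_maximalIdeal mem).2 reg)
  · rw [Module.support_eq_zeroLocus, Ideal.annihilator_quotient]
  · exact (Submodule.top_ne_ideal_smul_of_le_jacobson_annihilator
      (maximalIdeal_le_jacobson _)).symm.lt_top

end HomologicalDepth

lemma Submodule.exists_span_insert_range_eq_top {κ V : Type*} [Field κ] [AddCommGroup V]
    [Module κ V] [FiniteDimensional κ V] {n : ℕ} (hn : Module.finrank κ V = n + 1)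
    {v : V} (hv : v ≠ 0) : ∃ w : Fin n → V, span κ (insert v (Set.range w)) = ⊤ := by
  have h1 : Module.finrank κ (V ⧸ span κ {v}) = n := by
    have := (span κ {v}).finrank_quotient_add_finrank
    rw [finrank_span_singleton hv] at this
    omega
  let b := Module.finBasisOfFinrankEq κ (V ⧸ span κ {v}) h1
  choose w hw using fun i => (span κ {v}).mkQ_surjective (b i)
  refine ⟨w, ?_⟩
  rw [span_insert, ← map_mkQ_eq_top, map_span, ← Set.range_comp, ← b.span_eq]
  congr 2
  exact funext hw

namespace IsLocalRing

variable {B : Type*} [CommRing B] [IsLocalRing B] [IsNoetherianRing B]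

/-- An element outside `𝔪 ^ 2` drops the embedding dimension. -/
lemma exists_maximalIdeal_eq_span_insert {n : ℕ} (hn : (maximalIdeal B).spanFinrank = n + 1)
    {x : B} (hx : x ∈ maximalIdeal B) (hx2 : x ∉ maximalIdeal B ^ 2) :
    ∃ w : Fin n → B, maximalIdeal B = Ideal.span (insert x (Set.range w)) := by
  rw [spanFinrank_maximalIdeal_eq_finrank_cotangentSpace] at hn
  have hv : (maximalIdeal B).toCotangent ⟨x, hx⟩ ≠ 0 := by
    rwa [Ne, Ideal.toCotangent_eq_zero]
  obtain ⟨w, hw⟩ := Submodule.exists_span_insert_range_eq_top (V := CotangentSpace B) hn hv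
  choose y hy using fun i => (maximalIdeal B).toCotangent_surjective (w i)
  have h1 : (maximalIdeal B).toCotangent '' (insert ⟨x, hx⟩ (Set.range y)) =
      insert ((maximalIdeal B).toCotangent ⟨x, hx⟩) (Set.range w) := by
    rw [Set.image_insert_eq, ← Set.range_comp]
    congr 2
    exact funext hy
  rw [← h1, CotangentSpace.span_image_eq_top_iff] at hw
  refine ⟨fun i => y i, ?_⟩
  have := congrArg (Submodule.map (maximalIdeal B).subtype) hw
  rw [Submodule.map_span, Submodule.map_top, Submodule.range_subtype, Set.image_insert_eq,
    ← Set.range_comp] at this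
  exact this.symm

lemma exists_mem_maximalIdeal_notMem_sq (h : maximalIdeal B ≠ ⊥)
    (h' : maximalIdeal B ∉ minimalPrimes B) :
    ∃ x ∈ maximalIdeal B, x ∉ maximalIdeal B ^ 2 ∧ ∀ P ∈ minimalPrimes B, x ∉ P := by
  have hfin := minimalPrimes.finite_of_isNoetherianRing B
  by_contra! hc
  have hsub : (maximalIdeal B : Set B) ⊆ (maximalIdeal B ^ 2 : Ideal B) ∪
      (maximalIdeal B ^ 2 : Ideal B) ∪
      ⋃ i ∈ (hfin.toFinset : Set (Ideal B)), ((id i : Ideal B) : Set B) := by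
    intro x hx
    by_cases hx2 : x ∈ maximalIdeal B ^ 2
    · exact .inl (.inl hx2)
    · obtain ⟨P, hP, hxP⟩ := hc x hx hx2
      exact .inr (Set.mem_biUnion (by simpa using hP) hxP)
  have hsq : ¬ maximalIdeal B ≤ maximalIdeal B ^ 2 := fun hle =>
    h <| Submodule.eq_bot_of_le_smul_of_le_jacobson_bot (maximalIdeal B) _
      (IsNoetherian.noetherian _) (by rwa [smul_eq_mul, ← pow_two])
      (jacobson_eq_maximalIdeal ⊥ bot_ne_top).ge
  rcases (Ideal.subset_union_prime' (f := id) fun i hi => by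
    simpa using (hfin.mem_toFinset.1 hi).1.1).1 hsub with h1 | h1 | ⟨P, hP, h1⟩
  · exact hsq h1
  · exact hsq h1
  · have hP := hfin.mem_toFinset.1 hP
    have : P.IsPrime := hP.1.1
    exact h' ((le_antisymm h1 (le_maximalIdeal this.ne_top)).symm ▸ hP)

end IsLocalRing

open IsLocalRing RingTheory.Sequence Pointwise in
/-- A regular local ring is a domain, and its maximal ideal contains a regular sequence whose
length is the dimension. -/
theorem IsRegularLocalRing.isDomain_and_exists_isWeaklyRegular (n : ℕ) (B : Type*) [CommRing B]
    [IsRegularLocalRing B] (hn : (maximalIdeal B).spanFinrank = n) :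
    IsDomain B ∧ ∃ rs : List B, rs.length = n ∧ (∀ r ∈ rs, r ∈ maximalIdeal B) ∧
      IsWeaklyRegular B rs := by
  induction n generalizing B with
  | zero =>
    rw [Submodule.spanFinrank_eq_zero_iff_eq_bot (IsNoetherian.noetherian _)] at hn
    exact ⟨(isField_iff_maximalIdeal_eq.2 hn).isDomain, [], by simp⟩
  | succ n ih =>
    have hdim : ringKrullDim B = (n + 1 : ℕ) := by
      rw [← hn, IsRegularLocalRing.spanFinrank_maximalIdeal]
    obtain ⟨x, hx, hx2, hxmin⟩ := exists_mem_maximalIdeal_notMem_sq (B := B)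
      (by rintro h; rw [h, Submodule.spanFinrank_bot] at hn; omega)
      (fun h => by
        have h0 : (maximalIdeal B).height = 0 := Ideal.height_eq_zero_iff.2 h
        have h1 := maximalIdeal_height_eq_ringKrullDim (R := B)
        rw [h0, hdim] at h1
        exact absurd h1 (by norm_cast))
    obtain ⟨w, hw⟩ := exists_maximalIdeal_eq_span_insert hn hx hx2
    let I := Ideal.span {x}
    have hI : x • (⊤ : Submodule B B) = I := by
      rw [← Submodule.ideal_span_singleton_smul, Ideal.smul_top_eq_map]
      simp [I]
    have hIm : I ≤ maximalIdeal B := (Ideal.span_singleton_le_iff_mem _).2 hx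
    have : Nontrivial (B ⧸ I) := Ideal.Quotient.nontrivial_iff.2
      (ne_top_of_le_ne_top (maximalIdeal.isMaximal B).ne_top hIm)
    have : IsLocalRing (B ⧸ I) := .of_surjective' (Ideal.Quotient.mk I)
      Ideal.Quotient.mk_surjective
    have hmax : maximalIdeal (B ⧸ I) = Ideal.span (Set.range (Ideal.Quotient.mk I ∘ w)) := by
      have : maximalIdeal (B ⧸ I) = (maximalIdeal B).map (Ideal.Quotient.mk I) :=
        (map_maximalIdeal_of_surjective _ Ideal.Quotient.mk_surjective).symm
      rw [this, hw, Ideal.map_span, Set.image_insert_eq,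
        Ideal.Quotient.eq_zero_iff_mem.2 (Ideal.mem_span_singleton_self x), ← Set.range_comp]
      simp
    have hle : (maximalIdeal (B ⧸ I)).spanFinrank ≤ n := by
      rw [hmax]
      refine (Submodule.spanFinrank_span_le_ncard_of_finite (Set.finite_range _)).trans ?_
      rw [← Set.image_univ]
      exact (Set.ncard_image_le Set.finite_univ).trans (by simp)
    have hdim' : (n : WithBot ℕ∞) ≤ ringKrullDim (B ⧸ I) := by
      have := ringKrullDim_le_ringKrullDim_quotSMulTop_succ hx
      rw [hdim, hI] at this
      obtain ⟨d, hd⟩ := WithBot.ne_bot_iff_exists.1 (ringKrullDim_ne_bot (R := B ⧸ I))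
      rw [← hd] at this ⊢
      have h1 : ((n + 1 : ℕ) : ℕ∞) ≤ d + 1 := by exact_mod_cast this
      have h2 : (n : ℕ∞) ≤ d := by
        push_cast at h1
        exact (ENat.add_le_add_iff_right ENat.one_ne_top).1 h1
      exact_mod_cast h2
    have : IsRegularLocalRing (B ⧸ I) := .of_spanFinrank_maximalIdeal_le _
      (le_trans (by exact_mod_cast hle) hdim')
    obtain ⟨hdom, rs, hlen, mem, reg⟩ := ih (B ⧸ I) (hle.antisymm (by
      rw [← IsRegularLocalRing.spanFinrank_maximalIdeal (R := B ⧸ I)] at hdim'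
      exact_mod_cast hdim'))
    have hdomB : IsDomain B := by
      have hIp : I.IsPrime := (Ideal.Quotient.isDomain_iff_prime I).1 hdom
      obtain ⟨q, hq, hqI⟩ := Ideal.exists_minimalPrimes_le (I := ⊥) (J := I) bot_le
      have hxq := hxmin q hq
      have : q = ⊥ := by
        refine Submodule.eq_bot_of_le_smul_of_le_jacobson_bot I q (IsNoetherian.noetherian _) ?_
          (hIm.trans (jacobson_eq_maximalIdeal ⊥ bot_ne_top).ge)
        intro a ha
        obtain ⟨b, rfl⟩ := Ideal.mem_span_singleton.1 (hqI ha)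
        exact Submodule.smul_mem_smul (Ideal.mem_span_singleton_self x)
          ((hq.1.1.mem_or_mem ha).resolve_left hxq)
      have : (⊥ : Ideal B).IsPrime := this ▸ hq.1.1
      exact IsDomain.of_bot_isPrime B
    refine ⟨hdomB, ?_⟩
    have hx0 : x ≠ 0 := fun h => hx2 (h ▸ zero_mem _)
    choose s hs using fun r : B ⧸ I => Ideal.Quotient.mk_surjective r
    refine ⟨x :: rs.map s, by simp [hlen], ?_, ?_⟩
    · refine List.forall_mem_cons.2 ⟨hx, fun r hr => ?_⟩
      obtain ⟨r, hr', rfl⟩ := List.mem_map.1 hr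
      by_contra hc
      exact mem r hr' (hs r ▸ (notMem_maximalIdeal.1 hc).map (Ideal.Quotient.mk I))
    · refine .cons (fun a b h => mul_left_cancel₀ hx0 h) ?_
      rw [(Submodule.quotEquivOfEq _ _ hI).isWeaklyRegular_congr,
        ← isWeaklyRegular_map_algebraMap_iff (B ⧸ I), List.map_map]
      convert! reg
      refine (List.map_congr_left fun r _ => hs r).trans (List.map_id _)

lemma Ideal.height_le_height_comap_of_isIntegral {A R : Type*} [CommRing A] [CommRing R]
    [Algebra A R] [Algebra.IsIntegral A R] (P : Ideal R) [P.IsPrime] :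
    P.height ≤ (P.comap (algebraMap A R)).height := by
  have h := Order.height_le_height_apply_of_strictMono (PrimeSpectrum.comap (algebraMap A R))
    (fun x y h ↦ Ideal.IsIntegral.comap_lt_comap (R := A) (I := x.asIdeal) (J := y.asIdeal) h)
    ⟨P, inferInstance⟩
  rwa [← PrimeSpectrum.height_eq_orderHeight, ← PrimeSpectrum.height_eq_orderHeight] at h

/-- A finite module over a domain is, up to multiplication by a nonzero element, free. -/
lemma Module.exists_linearMap_comp_eq_smul (A M : Type*) [CommRing A] [IsDomain A]
    [AddCommGroup M] [Module A M] [Module.Finite A M] :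
    ∃ (ι : Type) (_ : Finite ι) (θ : M →ₗ[A] (ι →₀ A)) (ψ : (ι →₀ A) →ₗ[A] M) (a : A),
      a ≠ 0 ∧ ∀ x, ψ (θ x) = a • x := by
  obtain ⟨m, g, hg⟩ := Module.Finite.exists_fin (R := A) (M := M)
  obtain ⟨s, hs, hmax⟩ := exists_maximal_linearIndepOn A g
  have hs' : LinearIndependent A (fun x : s ↦ g x) := hs
  have key : ∀ i, ∃ a : A, a ≠ 0 ∧ a • g i ∈ Submodule.span A (Set.range fun x : s ↦ g x) := by
    intro i
    by_cases hi : i ∈ s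
    · exact ⟨1, one_ne_zero, by
        rw [one_smul]; exact Submodule.subset_span ⟨⟨i, hi⟩, rfl⟩⟩
    · obtain ⟨a, ha, h⟩ := hmax i hi
      exact ⟨a, ha, by rwa [Set.image_eq_range] at h⟩
  choose a ha h using key
  have hmem : ∀ x : M, (∏ i, a i) • x ∈ Submodule.span A (Set.range fun x : s ↦ g x) := by
    intro x
    have hx : x ∈ Submodule.span A (Set.range g) := hg ▸ Submodule.mem_top
    induction hx using Submodule.span_induction with
    | mem x hx =>
      obtain ⟨i, rfl⟩ := hx
      rw [← Finset.prod_erase_mul _ _ (Finset.mem_univ i), mul_smul]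
      exact Submodule.smul_mem _ _ (h i)
    | zero => simp
    | add x y _ _ hx hy => rw [smul_add]; exact add_mem hx hy
    | smul r x _ hx => rw [smul_comm]; exact Submodule.smul_mem _ _ hx
  refine ⟨s, inferInstance, hs'.repr.comp ((LinearMap.lsmul A M (∏ i, a i)).codRestrict _ hmem),
    Finsupp.linearCombination A fun x : s ↦ g x, ∏ i, a i,
    Finset.prod_ne_zero_iff.2 fun i _ ↦ ha i, fun x ↦ ?_⟩
  simp only [LinearMap.comp_apply, hs'.linearCombination_repr]
  rfl

lemma Ideal.linearMap_apply_mem_of_mem_map {A R : Type*} [CommRing A] [CommRing R] [Algebra A R]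
    (J : Ideal A) (f : R →ₗ[A] A) {x : R} (hx : x ∈ J.map (algebraMap A R)) : f x ∈ J := by
  have hx' : x ∈ (J.map (algebraMap A R)).restrictScalars A := hx
  rw [← Ideal.smul_top_eq_map] at hx'
  refine Submodule.smul_induction_on hx' (fun r hr y _ ↦ ?_) fun x y hx hy ↦ ?_
  · rw [map_smul, smul_eq_mul]
    exact J.mul_mem_right _ hr
  · rw [map_add]
    exact add_mem hx hy

lemma Ideal.linearMap_finsupp_apply_mem_map {A R ι : Type*} [CommRing A] [CommRing R] [Algebra A R]
    (J : Ideal A) (ψ : (ι →₀ A) →ₗ[A] R) {x : ι →₀ A} (hx : ∀ i, x i ∈ J) :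
    ψ x ∈ J.map (algebraMap A R) := by
  rw [← Finsupp.sum_single x, Finsupp.sum, map_sum]
  refine Submodule.sum_mem _ fun i _ ↦ ?_
  rw [← mul_one (x i), ← smul_eq_mul, ← Finsupp.smul_single, map_smul, Algebra.smul_def]
  exact Ideal.mul_mem_right _ _ (Ideal.mem_map_of_mem _ (hx i))

/-- A Frobenius splitting of `R` along `a` descends colon properties of Frobenius powers of
ideals of a base ring `A`, over which `R` is free up to multiplication by `a`, to `R`. -/
lemma Ideal.exists_mul_mem_map_of_frobenius_splitting {A R : Type*} [CommRing A]
    [CommRing R] [Algebra A R] (p e : ℕ) [Fact p.Prime] [CharP A p] [CharP R p] (φ : R →+ R)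
    (hφ : ∀ r x : R, φ (r ^ p ^ e * x) = r * φ x)
    {ι : Type*} [Finite ι] (θ : R →ₗ[A] (ι →₀ A)) (ψ : (ι →₀ A) →ₗ[A] R) (a : A)
    (hψ : ∀ x, ψ (θ x) = a • x) (hφa : φ (algebraMap A R a) = 1)
    (𝔭 : Ideal A) [𝔭.IsPrime] (I : Ideal A) (b : A)
    (hI : ∀ y : A, b ^ p ^ e * y ∈ I.map (iterateFrobenius A p e) →
      ∃ t ∉ 𝔭, t * y ∈ I.map (iterateFrobenius A p e))
    (r : R) (hr : algebraMap A R b * r ∈ I.map (algebraMap A R)) :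
    ∃ t ∉ 𝔭, algebraMap A R t * r ∈ I.map (algebraMap A R) := by
  cases nonempty_fintype ι
  set J := I.map (iterateFrobenius A p e) with hJ
  have hJR : (I.map (algebraMap A R)).map (iterateFrobenius R p e) = J.map (algebraMap A R) := by
    rw [hJ, Ideal.map_map, Ideal.map_map]
    congr 1
    ext x
    simp [iterateFrobenius_def]
  have hb := Ideal.mem_map_of_mem (iterateFrobenius R p e) hr
  rw [hJR, map_mul, iterateFrobenius_def, ← map_pow, iterateFrobenius_def] at hb
  have hb' : ∀ i, ∃ t ∉ 𝔭, t * θ (r ^ p ^ e) i ∈ J := fun i ↦ by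
    have := J.linearMap_apply_mem_of_mem_map (Finsupp.lapply i ∘ₗ θ) hb
    rw [← Algebra.smul_def, map_smul] at this
    exact hI _ this
  choose t ht htJ using hb'
  refine ⟨∏ i, t i, fun h ↦ ?_, ?_⟩
  · obtain ⟨i, -, hi⟩ := Ideal.IsPrime.prod_mem_iff.1 h
    exact ht i hi
  have h1 : ψ ((∏ i, t i) • θ (r ^ p ^ e)) ∈ J.map (algebraMap A R) := by
    classical
    refine J.linearMap_finsupp_apply_mem_map ψ fun i ↦ ?_
    rw [Finsupp.smul_apply, smul_eq_mul, ← Finset.prod_erase_mul _ _ (Finset.mem_univ i), mul_assoc]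
    exact J.mul_mem_left _ (htJ i)
  have h2 : (algebraMap A R (∏ i, t i) * r) ^ p ^ e * algebraMap A R a ∈ J.map (algebraMap A R) := by
    rw [map_smul, hψ, Algebra.smul_def, Algebra.smul_def] at h1
    have hpos : p ^ e - 1 + 1 = p ^ e :=
      Nat.succ_pred_eq_of_pos (pow_pos (Fact.out : p.Prime).pos e)
    convert Ideal.mul_mem_left _ (algebraMap A R (∏ i, t i) ^ (p ^ e - 1)) h1 using 1
    rw [mul_pow]
    conv_lhs => rw [← hpos, pow_succ, hpos]
    ring
  have h3 : ∀ x ∈ J.map (algebraMap A R), φ x ∈ I.map (algebraMap A R) := by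
    rw [← hJR]
    intro x hx
    have hx' : x ∈ Submodule.span R
      (iterateFrobenius R p e '' (I.map (algebraMap A R) : Set R)) := hx
    rw [← Set.image_id (iterateFrobenius R p e '' _),
      Submodule.mem_span_image_iff_exists_fun] at hx'
    obtain ⟨s, hs, c, rfl⟩ := hx'
    rw [map_sum]
    refine Submodule.sum_mem _ fun ⟨i, hi⟩ _ ↦ ?_
    obtain ⟨y, hy, hyi⟩ := hs hi
    generalize c ⟨i, hi⟩ = z
    change φ (z * i) ∈ _
    rw [mul_comm, ← hyi, iterateFrobenius_def, hφ]
    exact Ideal.mul_mem_right _ _ hy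
  simpa [hφ, hφa] using h3 _ h2

lemma RingTheory.Sequence.isWeaklyRegular_self_iff {B : Type*} [CommRing B] (rs : List B) :
    IsWeaklyRegular B rs ↔ ∀ i (h : i < rs.length) (x : B),
      rs[i] * x ∈ Ideal.ofList (rs.take i) → x ∈ Ideal.ofList (rs.take i) := by
  rw [isWeaklyRegular_iff]
  refine forall_congr' fun i ↦ forall_congr' fun h ↦ ?_
  rw [isSMulRegular_quotient_iff_mem_of_smul_mem]
  simp

lemma Ideal.ofList_map_pow_eq_map_iterateFrobenius {A : Type*} [CommRing A] (p e : ℕ)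
    [Fact p.Prime] [CharP A p] (l : List A) :
    Ideal.ofList (l.map (· ^ p ^ e)) = (Ideal.ofList l).map (iterateFrobenius A p e) := by
  rw [Ideal.map_ofList]
  rfl

open RingTheory.Sequence in
/-- Weakly regular sequences on a localization of the base, stable under Frobenius powers, stay
weakly regular on the localizations of a Frobenius split overring. -/
lemma isWeaklyRegular_map_of_frobenius_splitting {A R : Type*} [CommRing A]
    [CommRing R] [Algebra A R] (p e : ℕ) [Fact p.Prime] [CharP A p] [CharP R p] (φ : R →+ R)
    (hφ : ∀ r x : R, φ (r ^ p ^ e * x) = r * φ x)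
    {ι : Type*} [Finite ι] (θ : R →ₗ[A] (ι →₀ A)) (ψ : (ι →₀ A) →ₗ[A] R) (a : A)
    (hψ : ∀ x, ψ (θ x) = a • x) (hφa : φ (algebraMap A R a) = 1)
    (P : Ideal R) [P.IsPrime] (𝔭 : Ideal A) [𝔭.IsPrime] (h𝔭 : P.comap (algebraMap A R) = 𝔭)
    (l : List A)
    (hl : IsWeaklyRegular (Localization.AtPrime 𝔭)
      ((l.map (algebraMap A (Localization.AtPrime 𝔭))).map (· ^ p ^ e))) :
    IsWeaklyRegular (Localization.AtPrime P)
      ((l.map (algebraMap A R)).map (algebraMap R (Localization.AtPrime P))) := by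
  rw [isWeaklyRegular_self_iff] at hl ⊢
  intro i hi x hx
  simp only [List.length_map] at hi hl
  specialize hl i hi
  have hmap : (l.map (algebraMap A (Localization.AtPrime 𝔭))).map (· ^ p ^ e) =
      (l.map (· ^ p ^ e)).map (algebraMap A (Localization.AtPrime 𝔭)) := by
    simp [Function.comp_def]
  simp only [hmap, ← List.map_take, ← Ideal.map_ofList, List.getElem_map] at hl hx ⊢
  rw [Ideal.ofList_map_pow_eq_map_iterateFrobenius] at hl
  obtain ⟨r, s, rfl⟩ := IsLocalization.exists_mk'_eq P.primeCompl x
  rw [IsLocalization.mul_mk'_eq_mk'_of_mul, IsLocalization.mk'_mem_map_algebraMap_iff] at hx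
  obtain ⟨m, hm, hx⟩ := hx
  obtain ⟨t, ht, htr⟩ := Ideal.exists_mul_mem_map_of_frobenius_splitting p e φ hφ θ ψ a hψ hφa
    𝔭 (Ideal.ofList (l.take i)) l[i] (fun y hy ↦ by
      obtain ⟨t, ht, hty⟩ := (IsLocalization.algebraMap_mem_map_algebraMap_iff 𝔭.primeCompl
        (S := Localization.AtPrime 𝔭) _ _).1 (hl (algebraMap _ _ y) (by
          rw [← map_mul]; exact Ideal.mem_map_of_mem _ hy))
      exact ⟨t, ht, hty⟩) (m * r) (by rwa [mul_left_comm])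
  rw [IsLocalization.mk'_mem_map_algebraMap_iff]
  refine ⟨algebraMap A R t * m, P.primeCompl.mul_mem (fun h ↦ ht (h𝔭 ▸ h)) hm, ?_⟩
  rwa [mul_assoc]

open IsLocalRing RingTheory.Sequence in
theorem IsStronglyFRegular.isCohenMacaulayRing (k R : Type) [Field k] [CommRing R] [IsDomain R]
    [Algebra k R] [Algebra.FiniteType k R] (p : ℕ) [Fact p.Prime] [CharP k p]
    (h : IsStronglyFRegular R p) : IsCohenMacaulayRing R := by
  intro P hP
  obtain ⟨s, g, hg, hfin⟩ := exists_finite_inj_algHom_of_fg k R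
  algebraize [g.toRingHom]
  have : CharP R p := charP_of_injective_algebraMap (algebraMap k R).injective p
  have : IsNoetherianRing R := Algebra.FiniteType.isNoetherianRing k R
  set A := MvPolynomial (Fin s) k
  have hinj : Function.Injective (algebraMap A R) := hg
  have : Module.Finite A R := hfin
  obtain ⟨ι, _, θ, ψ, a, ha, hψ⟩ := Module.exists_linearMap_comp_eq_smul A R
  obtain ⟨e, φ, -, hφ, hφa⟩ := h (algebraMap A R a) fun Q hQ ↦ by
    rw [IsDomain.minimalPrimes_eq_singleton_bot, Set.mem_singleton_iff] at hQ
    simpa [hQ] using (map_ne_zero_iff _ hinj).2 ha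
  let 𝔭 := P.comap (algebraMap A R)
  let B := Localization.AtPrime 𝔭
  obtain ⟨-, rs, hlen, hmem, hreg⟩ :=
    IsRegularLocalRing.isDomain_and_exists_isWeaklyRegular _ B rfl
  obtain ⟨rs', hlen', hrs', hreg'⟩ := exists_isWeaklyRegular_pow
    (Q := fun r ↦ r ∈ Set.range (algebraMap A B)) (fun x hx ↦ by
      obtain ⟨x, s, rfl⟩ := IsLocalization.exists_mk'_eq 𝔭.primeCompl x
      exact ⟨algebraMap A B s, IsLocalization.map_units B s, x, by
        rw [IsLocalization.mk'_spec']⟩) (p ^ e) rs hmem hreg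
  have hl : ∃ l : List A, l.map (algebraMap A B) = rs' := by
    rw [← Set.mem_range, Set.range_list_map]
    exact fun r hr ↦ (hrs' r hr).2
  obtain ⟨l, rfl⟩ := hl
  have hregR := isWeaklyRegular_map_of_frobenius_splitting p e φ hφ θ ψ a hψ hφa P 𝔭 rfl l hreg'
  refine localDepth_eq_ringKrullDim (Localization.AtPrime P) (LocalizedModule P.primeCompl R)
    (LinearEquiv.refl _ _) _ ?_ hregR ?_
  · intro r hr
    simp only [List.map_map, List.mem_map, Function.comp_apply] at hr
    obtain ⟨x, hx, rfl⟩ := hr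
    have := (hrs' _ (List.mem_map_of_mem hx)).1
    rw [IsLocalization.AtPrime.to_map_mem_maximal_iff _ 𝔭] at this
    rw [IsLocalization.AtPrime.to_map_mem_maximal_iff _ P]
    exact this
  · rw [IsLocalization.AtPrime.ringKrullDim_eq_height P]
    have h1 := Ideal.height_le_height_comap_of_isIntegral (A := A) P
    have h2 := IsLocalization.AtPrime.ringKrullDim_eq_height 𝔭 B
    rw [← IsRegularLocalRing.spanFinrank_maximalIdeal, ← hlen, ← hlen'] at h2
    simp only [List.length_map] at h2 ⊢
    rw [h2]
    exact_mod_cast h1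

lemma RingHom.exists_addMonoidHom_apply_eq_one {K L : Type*} [Field K] [Field L] (σ : K →+* L)
    {c : L} (hc : c ≠ 0) : ∃ f : L →+ K, (∀ b x, f (σ b * x) = b * f x) ∧ f c = 1 := by
  algebraize [σ]
  obtain ⟨f, hf⟩ := (LinearMap.toSpanSingleton K L c).exists_leftInverse_of_injective
    (LinearMap.ker_eq_bot.2 (smul_left_injective K hc))
  refine ⟨f.toAddMonoidHom, fun b x ↦ ?_, ?_⟩
  · have := f.map_smul b x
    rwa [Algebra.smul_def] at this
  · simpa using LinearMap.congr_fun hf 1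

/-- If no positive multiple of `w` lies in a finitely generated submonoid, then only finitely many
multiples do so up to a fixed translation. -/
lemma AddSubmonoid.FG.finite_setOf_nsmul_add_mem {V : Type*} [AddCommGroup V]
    {S : AddSubmonoid V} (hfg : S.FG) {w : V} (hw : ∀ m : ℕ, 0 < m → m • w ∉ S) (a : V) :
    {q : ℕ | q • w + a ∈ S}.Finite := by
  by_contra hinf
  obtain ⟨f, hmono, hmem⟩ : ∃ f : ℕ → ℕ, StrictMono f ∧ ∀ i, f i • w + a ∈ S :=
    ⟨_, Nat.nth_strictMono hinf, Nat.nth_mem_of_infinite hinf⟩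
  obtain ⟨s, rfl⟩ := hfg
  simp only [AddSubmonoid.mem_closure_finset'] at hmem
  choose g hg using hmem
  obtain ⟨i, j, hij, hle⟩ := wellQuasiOrdered_le g
  refine hw (f j - f i) (Nat.sub_pos_of_lt (hmono hij)) ?_
  rw [AddSubmonoid.mem_closure_finset']
  refine ⟨g j - g i, ?_⟩
  have h : ∀ x : s, (g j - g i) x • (x : V) = g j x • (x : V) - g i x • (x : V) := fun x ↦ by
    rw [Pi.sub_apply, sub_nsmul _ (hle x), sub_eq_add_neg]
  rw [Finset.sum_congr rfl fun x _ ↦ h x, Finset.sum_sub_distrib, ← hg, ← hg,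
    sub_nsmul _ (hmono hij).le]
  abel

/-- In a saturated finitely generated submonoid of a lattice, divisibility up to a fixed error is
detected by large multiples. -/
lemma AddSubmonoid.FG.exists_forall_mem_of_nsmul_add_mem {n : ℕ} {S : AddSubmonoid (Fin n → ℤ)}
    (hfg : S.FG)
    (hnormal : ∀ x : Fin n → ℤ, x ∈ AddSubgroup.closure (S : Set (Fin n → ℤ)) →
      (∃ m : ℕ, 0 < m ∧ m • x ∈ S) → x ∈ S) (a : Fin n → ℤ) :
    ∃ N : ℕ, ∀ q ≥ N, ∀ w ∈ AddSubgroup.closure (S : Set (Fin n → ℤ)), q • w + a ∈ S → w ∈ S := by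
  obtain ⟨s, hs⟩ := id hfg
  have hS : ∀ x, x ∈ S ↔ ∃ b : s → ℕ, x = ∑ i, b i • (i : Fin n → ℤ) := fun x ↦ by
    rw [← hs, AddSubmonoid.mem_closure_finset']
  let C : Fin n → ℤ := ∑ i : s, |(i : Fin n → ℤ)| + |a|
  have hfin : (⋃ w ∈ Set.Icc (-C) C ∩ {w | w ∈ AddSubgroup.closure (S : Set (Fin n → ℤ)) ∧ w ∉ S},
      {q : ℕ | q • w + a ∈ S}).Finite :=
    Set.Finite.biUnion ((Set.finite_Icc _ _).inter_of_left _) fun w hw ↦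
      hfg.finite_setOf_nsmul_add_mem (fun m hm h ↦ hw.2.2 (hnormal w hw.2.1 ⟨m, hm, h⟩)) a
  obtain ⟨N, hN⟩ := hfin.bddAbove
  refine ⟨N + 1, fun q hq w hw hqw ↦ ?_⟩
  by_contra hwS
  obtain ⟨b, hb⟩ := (hS _).1 hqw
  let u := ∑ i, (b i / q) • (i : Fin n → ℤ)
  have hu : u ∈ S := (hS _).2 ⟨_, rfl⟩
  have hmod : q • (w - u) + a = ∑ i, (b i % q) • (i : Fin n → ℤ) := by
    have : ∀ i : s, b i • (i : Fin n → ℤ) = q • (b i / q) • (i : Fin n → ℤ) +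
        (b i % q) • (i : Fin n → ℤ) := fun i ↦ by
      rw [← mul_nsmul', ← add_nsmul, Nat.div_add_mod]
    rw [Finset.sum_congr rfl fun i _ ↦ this i, Finset.sum_add_distrib, ← Finset.smul_sum] at hb
    rw [nsmul_sub, sub_add_eq_add_sub, hb]
    exact add_sub_cancel_left _ _
  have hq0 : 0 < q := by omega
  have habs : ∀ j, |(w - u) j| ≤ C j := fun j ↦ by
    have h1 := congrFun hmod j
    simp only [Pi.add_apply, Pi.smul_apply, Finset.sum_apply] at h1
    simp only [nsmul_eq_mul] at h1
    have h2 : |∑ i : s, ((b i % q : ℕ) : ℤ) * (i : Fin n → ℤ) j| ≤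
        ∑ i : s, q * |(i : Fin n → ℤ) j| := by
      refine (Finset.abs_sum_le_sum_abs _ _).trans (Finset.sum_le_sum fun i _ ↦ ?_)
      rw [abs_mul, Nat.abs_cast]
      gcongr
      exact (Nat.mod_lt _ hq0).le
    rw [← h1, ← Finset.mul_sum] at h2
    have h3 : (q : ℤ) * |(w - u) j| ≤ q * ∑ i : s, |(i : Fin n → ℤ) j| + |a j| := by
      rw [← Nat.abs_cast q, ← abs_mul, Nat.abs_cast q]
      have := abs_sub ((q : ℤ) * (w - u) j + a j) (a j)
      rw [add_sub_cancel_right] at this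
      linarith
    have h4 : |a j| ≤ q * |a j| := le_mul_of_one_le_left (abs_nonneg _) (by exact_mod_cast hq0)
    have hq0' : (0 : ℤ) < q := by exact_mod_cast hq0
    have hC : C j = ∑ i : s, |(i : Fin n → ℤ) j| + |a j| := by simp [C]
    rw [hC]
    exact le_of_mul_le_mul_left (by linarith) hq0'
  have := hN (Set.mem_biUnion (x := w - u) ⟨⟨fun j ↦ (abs_le.1 (habs j)).1,
    fun j ↦ (abs_le.1 (habs j)).2⟩, sub_mem hw (AddSubgroup.subset_closure hu),
    fun h ↦ hwS (by simpa using add_mem h hu)⟩ (show q ∈ {q : ℕ | q • (w - u) + a ∈ S} from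
      (hS _).2 ⟨_, hmod⟩))
  omega

/-- Let `f` be a `q`-inverse-linear functional on `k`, with `q = p ^ e`. The additive map on a
monoid algebra sending `b • x ^ (q • w + a)` to `f b • x ^ w` and killing the other monomials is
`q`-inverse-linear if `q • T + a` is stable under those translations by `q • T` that fix `T`. -/
lemma AddMonoidAlgebra.exists_addMonoidHom_frobenius {k T : Type*} [Field k] (p e : ℕ)
    [Fact p.Prime] [CharP k p] [AddCommMonoid T] [IsCancelAdd T] (f : k →+ k)
    (hf : ∀ b x, f (b ^ p ^ e * x) = b * f x) (a : T)
    (hinj : Function.Injective fun w : T ↦ p ^ e • w)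
    (hT : ∀ u v w : T, p ^ e • u + v = p ^ e • w + a → ∃ w' : T, v = p ^ e • w' + a) :
    ∃ φ : AddMonoidAlgebra k T →+ AddMonoidAlgebra k T,
      (∀ r x, φ (r ^ p ^ e * x) = r * φ x) ∧
      (∀ w b, φ (single (p ^ e • w + a) b) = single w (f b)) ∧
      ∀ v b, (∀ w, v ≠ p ^ e • w + a) → φ (single v b) = 0 := by
  classical
  let g : T → k →+ AddMonoidAlgebra k T := fun v ↦
    if h : ∃ w : T, v = p ^ e • w + a then (singleAddHom h.choose).comp f else 0
  let φ : AddMonoidAlgebra k T →+ AddMonoidAlgebra k T :=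
    (Finsupp.liftAddHom g).comp coeffAddEquiv.toAddMonoidHom
  have hφ : ∀ v b, φ (single v b) = g v b := fun v b ↦ by simp [φ]
  have h1 : ∀ w b, φ (single (p ^ e • w + a) b) = single w (f b) := fun w b ↦ by
    have h : ∃ w' : T, p ^ e • w + a = p ^ e • w' + a := ⟨w, rfl⟩
    rw [hφ]
    simp only [g, dif_pos h, AddMonoidHom.comp_apply, singleAddHom_apply]
    rw [← hinj (add_right_cancel h.choose_spec)]
  have h2 : ∀ v b, (∀ w, v ≠ p ^ e • w + a) → φ (single v b) = 0 := fun v b h ↦ by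
    rw [hφ]
    simp [g, h]
  refine ⟨φ, fun r x ↦ ?_, h1, h2⟩
  have : CharP (AddMonoidAlgebra k T) p :=
    charP_of_injective_algebraMap (algebraMap k (AddMonoidAlgebra k T)).injective p
  have key : ∀ u b v c, φ (single u b ^ p ^ e * single v c) = single u b * φ (single v c) := by
    intro u b v c
    rw [single_pow, single_mul_single]
    by_cases h : ∃ w, v = p ^ e • w + a
    · obtain ⟨w, rfl⟩ := h
      rw [← add_assoc, ← nsmul_add, h1, h1, hf, single_mul_single]
    · rw [h2 v c fun w hw ↦ h ⟨w, hw⟩, h2 _ _ fun w hw ↦ h (hT u v w hw), mul_zero]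
  induction x using induction_linear with
  | zero => simp
  | add x y hx hy => rw [mul_add, map_add, hx, hy, map_add, mul_add]
  | single v c =>
    induction r using induction_linear with
    | zero => simp [(Fact.out : p.Prime).ne_zero]
    | add r s hr hs => rw [add_pow_char_pow, add_mul, map_add, hr, hs, add_mul]
    | single u b => exact key u b v c

instance AddMonoidAlgebra.isDomain_addSubmonoid {k V : Type*} [Field k] [AddCommGroup V]
    [UniqueSums V] (S : AddSubmonoid V) : IsDomain (AddMonoidAlgebra k S) :=
  have : UniqueSums S := UniqueSums.of_injective_addHom S.subtype.toAddHom Subtype.val_injective ‹_›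
  have : NoZeroDivisors (AddMonoidAlgebra k S) := inferInstance
  NoZeroDivisors.to_isDomain _

lemma AddMonoidAlgebra.isStronglyFRegular_of_normal (k : Type) [Field k] (p : ℕ) [Fact p.Prime]
    [CharP k p] {n : ℕ} (S : AddSubmonoid (Fin n → ℤ)) (hfg : S.FG)
    (hnormal : ∀ x : Fin n → ℤ, x ∈ AddSubgroup.closure (S : Set (Fin n → ℤ)) →
      (∃ m : ℕ, 0 < m ∧ m • x ∈ S) → x ∈ S) :
    IsStronglyFRegular (AddMonoidAlgebra k S) p := by
  intro c hc
  have hc0 : c ≠ 0 := by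
    rw [IsDomain.minimalPrimes_eq_singleton_bot] at hc
    simpa using hc ⊥ rfl
  have hp : 1 < p := (Fact.out : p.Prime).one_lt
  obtain ⟨a, ha⟩ : c.coeff.support.Nonempty := by
    rw [Finsupp.support_nonempty_iff]
    exact fun h ↦ hc0 (by ext; simp [h])
  obtain ⟨N, hN⟩ := hfg.exists_forall_mem_of_nsmul_add_mem hnormal a
  let M := ∑ v ∈ c.coeff.support, ∑ j, ((v - a : Fin n → ℤ) j).natAbs
  let e := N + M + 1
  have he : N + M + 1 < p ^ e := Nat.lt_pow_self hp
  obtain ⟨f, hf, hf1⟩ := (iterateFrobenius k p e).exists_addMonoidHom_apply_eq_one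
    (Finsupp.mem_support_iff.1 ha)
  have hinj : Function.Injective fun w : Fin n → ℤ ↦ p ^ e • w :=
    nsmul_right_injective (by omega)
  obtain ⟨φ, hφ, hφ1, hφ2⟩ := AddMonoidAlgebra.exists_addMonoidHom_frobenius p e f hf a
    (fun w w' h ↦ Subtype.ext (hinj (by simpa using congrArg Subtype.val h))) fun u v w h ↦ by
      have h' : p ^ e • (u : Fin n → ℤ) + v = p ^ e • (w : Fin n → ℤ) + a := by
        simpa using congrArg Subtype.val h
      have hv : (v : Fin n → ℤ) = p ^ e • (w - u : Fin n → ℤ) + a := by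
        rw [nsmul_sub, sub_add_eq_add_sub, ← h', add_sub_cancel_left]
      exact ⟨⟨w - u, hN _ (by omega) _ (sub_mem (AddSubgroup.subset_closure w.2)
        (AddSubgroup.subset_closure u.2)) (hv ▸ v.2)⟩, Subtype.ext hv⟩
  refine ⟨e, φ, by omega, hφ, ?_⟩
  have hsum : c = ∑ v ∈ c.coeff.support, single v (c.coeff v) := (sum_coeff_single c).symm
  rw [hsum, map_sum, Finset.sum_eq_single_of_mem a ha]
  · have := hφ1 0 (c.coeff a)
    rwa [nsmul_zero, zero_add, hf1, ← one_def] at this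
  · intro v hv hva
    refine hφ2 v _ fun w hw ↦ hva ?_
    have hw' : (v - a : Fin n → ℤ) = p ^ e • (w : Fin n → ℤ) := by
      rw [hw]; exact add_sub_cancel_right _ _
    have hw0 : (w : Fin n → ℤ) = 0 := by
      ext j
      have h1 : ((v - a : Fin n → ℤ) j).natAbs < p ^ e := by
        refine lt_of_le_of_lt ?_ ((by omega : M < N + M + 1).trans he)
        exact (Finset.single_le_sum (f := fun j ↦ ((v - a : Fin n → ℤ) j).natAbs)
          (fun _ _ ↦ zero_le) (Finset.mem_univ j)).trans
          (Finset.single_le_sum (f := fun v : S ↦ ∑ j, ((v - a : Fin n → ℤ) j).natAbs)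
            (fun _ _ ↦ zero_le) hv)
      rw [hw', Pi.smul_apply, nsmul_eq_mul, Int.natAbs_mul, Int.natAbs_natCast] at h1
      by_contra hj
      exact absurd h1 (not_lt.2 (Nat.le_mul_of_pos_right _ (Int.natAbs_pos.2 hj)))
    rw [hw, show w = 0 from Subtype.ext hw0, nsmul_zero, zero_add]

/-- **Affine normal semigroup rings are strongly F-regular.**
Let `k` be a field of characteristic `p > 0` and `S ⊆ ℤ^n` a finitely generated
normal (saturated) submonoid.  Then the semigroup ring `k[S]` is strongly
F-regular; in particular it is Cohen–Macaulay. -/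
theorem addMonoidAlgebra_isStronglyFRegular
    (k : Type) [Field k] (p : ℕ) [Fact p.Prime] [CharP k p]
    (n : ℕ) (S : AddSubmonoid (Fin n → ℤ)) (hfg : S.FG)
    (hnormal : ∀ x : Fin n → ℤ,
      x ∈ AddSubgroup.closure (S : Set (Fin n → ℤ)) →
      (∃ m : ℕ, 0 < m ∧ m • x ∈ S) → x ∈ S) :
    IsStronglyFRegular (AddMonoidAlgebra k S) p ∧
      IsCohenMacaulayRing (AddMonoidAlgebra k S) := by
  have h := AddMonoidAlgebra.isStronglyFRegular_of_normal k p S hfg hnormal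
  have : AddMonoid.FG S := (AddMonoid.fg_iff_addSubmonoid_fg S).2 hfg
  exact ⟨h, h.isCohenMacaulayRing k _ p⟩
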